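/- arXiv:1903.04179 — 2 statements merged into one kernel-verified Lean document; each statement's English description precedes it below -/
import Mathlib

section
/- Let E be a Riesz space. The binary relation ⊑ defined by y ⊑ x iff |y| ⊓ |x − y| = 0 is a partial order on E: it is reflexive, antisymmetric, and transitive. -/
/-- In a Riesz space, `y` is a fragment of `x` (notation `y ⊑ x`) if `|y| ⊓ |x - y| = 0`. -/
def Fragment {E : Type*} [Lattice E] [AddCommGroup E] (y x : E) : Prop :=
  |y| ⊓ |x - y| = 0

theorem inf_add_le_inf_add_inf {E : Type*} [Lattice E] [AddCommGroup E] [AddLeftMono E]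
    {a b c : E} (ha : 0 ≤ a) (hb : 0 ≤ b) (hc : 0 ≤ c) : a ⊓ (b + c) ≤ a ⊓ b + a ⊓ c := by
  rw [add_inf, inf_add, inf_add]
  refine le_inf (le_inf ?_ ?_) (le_inf ?_ inf_le_right)
  · exact inf_le_left.trans (le_add_of_nonneg_right ha)
  · exact inf_le_left.trans (le_add_of_nonneg_left hb)
  · exact inf_le_left.trans (le_add_of_nonneg_right hc)

/-- An element below the sum of two nonnegative elements, and disjoint from both, is not positive. -/
theorem nonpos_of_le_add_of_inf_nonpos {E : Type*} [Lattice E] [AddCommGroup E] [AddLeftMono E]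
    {a b c : E} (ha : 0 ≤ a) (hb : 0 ≤ b) (hc : 0 ≤ c) (h : a ≤ b + c)
    (hab : a ⊓ b ≤ 0) (hac : a ⊓ c ≤ 0) : a ≤ 0 :=
  (le_inf le_rfl h).trans ((inf_add_le_inf_add_inf ha hb hc).trans (add_nonpos hab hac))

/-- The fragment relation `⊑` on a Riesz space is a partial order:
reflexive, antisymmetric, and transitive. -/
theorem fragment_partialOrder {E : Type*} [Lattice E] [AddCommGroup E]
    [CovariantClass E E (· + ·) (· ≤ ·)] [Module ℝ E] [PosSMulMono ℝ E] :
    (∀ x : E, Fragment x x) ∧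
    (∀ x y : E, Fragment x y → Fragment y x → x = y) ∧
    (∀ x y z : E, Fragment x y → Fragment y z → Fragment x z) := by
  refine ⟨fun x => ?_, fun x y hxy hyx => ?_, fun x y z hxy hyz => ?_⟩
  · simp [Fragment]
  · simp only [Fragment] at hxy hyx
    have h : |x - y| ≤ 0 := by
      refine nonpos_of_le_add_of_inf_nonpos (abs_nonneg _) (abs_nonneg x) (abs_nonneg y) ?_ ?_ ?_
      · simpa [sub_eq_add_neg] using abs_add_le x (-y)
      · rw [inf_comm, abs_sub_comm, hxy]
      · rw [inf_comm, hyx]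
    exact le_antisymm (sub_nonpos.mp ((le_abs_self _).trans h))
      (sub_nonpos.mp ((neg_sub x y ▸ neg_le_abs (x - y)).trans h))
  · simp only [Fragment] at hxy hyz ⊢
    have h : |x| ⊓ |z - y| ≤ 0 := by
      refine nonpos_of_le_add_of_inf_nonpos (le_inf (abs_nonneg _) (abs_nonneg _))
        (abs_nonneg y) (abs_nonneg (y - x)) ?_ ?_ ?_
      · have hx := abs_add_le y (x - y)
        rw [add_sub_cancel, abs_sub_comm x y] at hx
        exact inf_le_left.trans hx
      · rw [inf_assoc, inf_comm |z - y|, hyz]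
        exact inf_le_right
      · exact (inf_le_inf_right _ inf_le_left).trans hxy.le
    have hzx := abs_add_le (z - y) (y - x)
    rw [sub_add_sub_cancel] at hzx
    refine le_antisymm ?_ (le_inf (abs_nonneg _) (abs_nonneg _))
    exact (inf_le_inf_left _ hzx).trans ((inf_add_le_inf_add_inf (abs_nonneg _) (abs_nonneg _)
      (abs_nonneg _)).trans (add_nonpos h hxy.le))
end

section
/- Let E be a σ-Dedekind complete Riesz space (every countable order-bounded subset has a supremum) and let (x_n) be an order bounded pairwise disjoint sequence in E (|x_i| ⊓ |x_j| = 0 for i ≠ j, and there is a ∈ E with |x_n| ≤ a for all n). Then there exists y ∈ E such that the partial sums y_n = x_1 + ⋯ + x_n satisfy y_n ⊑ y_m ⊑ y for all n ≤ m, and (y_n) order converges to y; that is, (y_n) laterally converges to y. -/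
section LatticeOrderedGroup

variable {E : Type*} [Lattice E] [AddCommGroup E] [IsOrderedAddMonoid E]

theorem inf_add_le_inf_add_inf_of_nonneg {u v w : E} (hu : 0 ≤ u) (hv : 0 ≤ v) (hw : 0 ≤ w) :
    u ⊓ (v + w) ≤ u ⊓ v + u ⊓ w := by
  rw [inf_add, add_inf, add_inf]
  refine le_inf (le_inf ?_ ?_) (le_inf ?_ inf_le_right)
  · exact inf_le_left.trans (le_add_of_nonneg_left hu)
  · exact inf_le_left.trans (le_add_of_nonneg_right hw)
  · exact inf_le_left.trans (le_add_of_nonneg_left hv)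

theorem abs_inf_abs_add_le (u v w : E) : |u| ⊓ |v + w| ≤ |u| ⊓ |v| + |u| ⊓ |w| :=
  (inf_le_inf_left _ (abs_add_le v w)).trans
    (inf_add_le_inf_add_inf_of_nonneg (abs_nonneg u) (abs_nonneg v) (abs_nonneg w))

theorem abs_inf_abs_nonneg (u v : E) : 0 ≤ |u| ⊓ |v| :=
  le_inf (abs_nonneg u) (abs_nonneg v)

theorem abs_inf_abs_sum_eq_zero {ι : Type*} {s : Finset ι} {c : E} {x : ι → E}
    (h : ∀ i ∈ s, |c| ⊓ |x i| = 0) : |c| ⊓ |∑ i ∈ s, x i| = 0 := by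
  refine Finset.sum_induction x (fun v => |c| ⊓ |v| = 0) (fun v w hv hw => ?_) (by simp) h
  refine le_antisymm ?_ (abs_inf_abs_nonneg _ _)
  simpa [hv, hw] using abs_inf_abs_add_le c v w

theorem abs_sum_inf_abs_sum_eq_zero {ι : Type*} {s t : Finset ι} {x : ι → E}
    (hst : Disjoint s t) (hx : ∀ i j, i ≠ j → |x i| ⊓ |x j| = 0) :
    |∑ i ∈ s, x i| ⊓ |∑ i ∈ t, x i| = 0 := by
  refine abs_inf_abs_sum_eq_zero fun j hj => ?_
  rw [inf_comm]
  exact abs_inf_abs_sum_eq_zero fun i hi =>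
    hx j i fun hji => Finset.disjoint_left.mp hst hi (hji ▸ hj)

theorem sum_range_abs_le_of_disjoint {x : ℕ → E} {a : E} (hbdd : ∀ n, |x n| ≤ a)
    (hx : ∀ i j, i ≠ j → |x i| ⊓ |x j| = 0) (n : ℕ) : ∑ i ∈ Finset.range n, |x i| ≤ a := by
  induction n with
  | zero => simpa using (abs_nonneg (x 0)).trans (hbdd 0)
  | succ n ih =>
    have hd : |x n| ⊓ |∑ i ∈ Finset.range n, (|x i|)| = 0 :=
      abs_inf_abs_sum_eq_zero fun i hi => by
        rw [abs_abs]
        exact hx n i (Finset.mem_range.mp hi).ne'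
    rw [abs_of_nonneg (Finset.sum_nonneg fun i _ => abs_nonneg (x i))] at hd
    rw [Finset.sum_range_succ, add_comm, ← inf_add_sup, hd, zero_add]
    exact sup_le (hbdd n) ih

theorem isGLB_range_sub_add_sub {P N : ℕ → E} {p q : E} (hP : Monotone P) (hN : Monotone N)
    (hp : IsLUB (Set.range P) p) (hq : IsLUB (Set.range N) q) :
    IsGLB (Set.range fun n => (p - P n) + (q - N n)) 0 := by
  constructor
  · rintro _ ⟨n, rfl⟩
    exact add_nonneg (sub_nonneg.mpr (hp.1 ⟨n, rfl⟩)) (sub_nonneg.mpr (hq.1 ⟨n, rfl⟩))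
  · intro b hb
    have key : ∀ i j, P i + N j ≤ p + q - b := fun i j => by
      have h1 : b ≤ (p - P (max i j)) + (q - N (max i j)) := hb ⟨max i j, rfl⟩
      have h2 := add_le_add (hP (le_max_left i j)) (hN (le_max_right i j))
      rw [sub_add_sub_comm] at h1
      exact h2.trans (le_sub_comm.mp h1)
    have hq' : q ≤ q - b := hq.2 (by
      rintro _ ⟨j, rfl⟩
      have : p ≤ p + q - b - N j := hp.2 (by
        rintro _ ⟨i, rfl⟩
        exact le_sub_iff_add_le.mpr (key i j))
      rw [le_sub_iff_add_le, add_sub_assoc] at this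
      exact le_of_add_le_add_left this)
    simpa using hq'

theorem fragment_sum_range {x : ℕ → E} (hx : ∀ i j, i ≠ j → |x i| ⊓ |x j| = 0) {n m : ℕ}
    (hnm : n ≤ m) : Fragment (∑ i ∈ Finset.range n, x i) (∑ i ∈ Finset.range m, x i) := by
  have hsub : Finset.range n ⊆ Finset.range m := Finset.range_mono hnm
  rw [Fragment, ← Finset.sum_sdiff_eq_sub hsub]
  exact abs_sum_inf_abs_sum_eq_zero Finset.disjoint_sdiff hx

/-- Fragments pass to order limits of the ambient element. -/
theorem Fragment.of_order_limit {S z : ℕ → E} {y : E}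
    (hS : ∀ n m, n ≤ m → Fragment (S n) (S m)) (hz : Antitone z)
    (hz0 : IsGLB (Set.range z) 0) (hSy : ∀ n, |S n - y| ≤ z n) (m : ℕ) : Fragment (S m) y := by
  refine le_antisymm (hz0.2 ?_) (abs_inf_abs_nonneg _ _)
  rintro _ ⟨k, rfl⟩
  have hfrag : |S m| ⊓ |S (max m k) - S m| = 0 := hS m _ (le_max_left m k)
  calc |S m| ⊓ |y - S m|
      = |S m| ⊓ |(S (max m k) - S m) + (y - S (max m k))| := by rw [sub_add_sub_cancel']
    _ ≤ |S m| ⊓ |S (max m k) - S m| + |S m| ⊓ |y - S (max m k)| := abs_inf_abs_add_le _ _ _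
    _ ≤ |S (max m k) - y| := by rw [hfrag, zero_add, abs_sub_comm]; exact inf_le_right
    _ ≤ z (max m k) := hSy _
    _ ≤ z k := hz (le_max_right m k)

end LatticeOrderedGroup

/-- In a σ-Dedekind complete Riesz space, the partial sums of an order bounded
pairwise disjoint sequence laterally converge: there is `y` such that
`y_n ⊑ y_m ⊑ y` for `n ≤ m` and the partial sums order converge to `y`. -/
theorem partialSums_laterally_converge {E : Type*} [Lattice E] [AddCommGroup E]
    [CovariantClass E E (· + ·) (· ≤ ·)] [Module ℝ E] [PosSMulMono ℝ E]
    (hσ : ∀ f : ℕ → E, (∃ a b : E, ∀ n, a ≤ f n ∧ f n ≤ b) →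
      ∃ s, IsLUB (Set.range f) s)
    (x : ℕ → E) (a : E) (hbdd : ∀ n, |x n| ≤ a)
    (hdisj : ∀ i j, i ≠ j → |x i| ⊓ |x j| = 0) :
    ∃ y : E,
      (∀ n m, n ≤ m →
        Fragment (∑ i ∈ Finset.range n, x i) (∑ i ∈ Finset.range m, x i) ∧
        Fragment (∑ i ∈ Finset.range m, x i) y) ∧
      ∃ z : ℕ → E, Antitone z ∧ IsGLB (Set.range z) 0 ∧
        ∀ n, |(∑ i ∈ Finset.range n, x i) - y| ≤ z n := by
  have : IsOrderedAddMonoid E :=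
    { add_le_add_left := fun _ _ h c => by
        simpa only [add_comm _ c] using CovariantClass.elim (μ := (· + ·)) c h }
  have exists_lub : ∀ f : ℕ → E, (∀ n, 0 ≤ f n) → (∀ n, f n ≤ |x n|) →
      ∃ s, IsLUB (Set.range fun n => ∑ i ∈ Finset.range n, f i) s := fun f hf0 hf =>
    hσ _ ⟨0, a, fun n => ⟨Finset.sum_nonneg fun i _ => hf0 i,
      (Finset.sum_le_sum fun i _ => hf i).trans (sum_range_abs_le_of_disjoint hbdd hdisj n)⟩⟩
  have mono : ∀ f : ℕ → E, (∀ n, 0 ≤ f n) → Monotone fun n => ∑ i ∈ Finset.range n, f i :=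
    fun f hf => monotone_nat_of_le_succ fun n => by
      rw [Finset.sum_range_succ]
      exact le_add_of_nonneg_right (hf n)
  obtain ⟨p, hp⟩ := exists_lub (fun n => (x n)⁺) (fun n => posPart_nonneg _)
    fun n => sup_le (le_abs_self _) (abs_nonneg _)
  obtain ⟨q, hq⟩ := exists_lub (fun n => (x n)⁻) (fun n => negPart_nonneg _)
    fun n => sup_le (neg_le_abs _) (abs_nonneg _)
  have hP := mono (fun n => (x n)⁺) fun n => posPart_nonneg _
  have hN := mono (fun n => (x n)⁻) fun n => negPart_nonneg _
  have hz := isGLB_range_sub_add_sub hP hN hp hq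
  have hanti : Antitone fun n =>
      (p - ∑ i ∈ Finset.range n, (x i)⁺) + (q - ∑ i ∈ Finset.range n, (x i)⁻) := fun n m h =>
    add_le_add (sub_le_sub_left (hP h) p) (sub_le_sub_left (hN h) q)
  have hconv : ∀ n, |(∑ i ∈ Finset.range n, x i) - (p - q)| ≤
      (p - ∑ i ∈ Finset.range n, (x i)⁺) + (q - ∑ i ∈ Finset.range n, (x i)⁻) := fun n => by
    have hsum : ∑ i ∈ Finset.range n, x i =
        ∑ i ∈ Finset.range n, (x i)⁺ - ∑ i ∈ Finset.range n, (x i)⁻ := by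
      simp only [← Finset.sum_sub_distrib, posPart_sub_negPart]
    have hp0 := sub_nonneg.mpr (hp.1 ⟨n, rfl⟩)
    have hq0 := sub_nonneg.mpr (hq.1 ⟨n, rfl⟩)
    calc |(∑ i ∈ Finset.range n, x i) - (p - q)|
        = |(q - ∑ i ∈ Finset.range n, (x i)⁻) + -(p - ∑ i ∈ Finset.range n, (x i)⁺)| := by
          rw [hsum]; congr 1; abel
      _ ≤ _ := abs_add_le _ _
      _ = _ := by rw [abs_neg, abs_of_nonneg hp0, abs_of_nonneg hq0, add_comm]
  exact ⟨p - q, fun n m hnm => ⟨fragment_sum_range hdisj hnm,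
    Fragment.of_order_limit (fun _ _ h => fragment_sum_range hdisj h) hanti hz hconv m⟩,
    _, hanti, hz, hconv⟩
end
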